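/- Let 𝓓 = (Ω, 𝓑) be a pliable 4-hypergraph in which any two points are collinear, and fix x ∈ Ω. Then the hole stabilizer π_x(𝓓) is generated, as a subgroup of Sym(Ω), by the closed move sequences of length three: π_x(𝓓) = ⟨ [x,a,b,x] : a, b ∈ Ω \ {x} ⟩, where [x,a,b,x] = [x,a]·[a,b]·[b,x]. -/

import Mathlib

open Equiv

variable {Ω : Type*} [DecidableEq Ω] [Fintype Ω]

/-- Two points of a 4-hypergraph are collinear if they are equal or some line contains both. -/
def HGCollinear (B : Finset (Finset Ω)) (x y : Ω) : Prop :=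
  x = y ∨ ∃ b ∈ B, x ∈ b ∧ y ∈ b

/-- A 4-hypergraph is pliable if any two lines sharing three pairwise distinct points are equal. -/
def HGPliable (B : Finset (Finset Ω)) : Prop :=
  ∀ b₁ ∈ B, ∀ b₂ ∈ B, ∀ p q r : Ω, p ≠ q → p ≠ r → q ≠ r →
    p ∈ b₁ → q ∈ b₁ → r ∈ b₁ → p ∈ b₂ → q ∈ b₂ → r ∈ b₂ → b₁ = b₂

/-- `g` is the elementary move `[x,y]`: it interchanges `x` and `y`, interchanges the
remaining two points of every line through `x` and `y`, and fixes everything else.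
For `x = y` it is the identity. -/
def IsElemMove (B : Finset (Finset Ω)) (x y : Ω) (g : Equiv.Perm Ω) : Prop :=
  (x = y ∧ g = 1) ∨
  (x ≠ y ∧ (∃ b ∈ B, x ∈ b ∧ y ∈ b) ∧ g x = y ∧ g y = x ∧
    ∀ z : Ω, z ≠ x → z ≠ y →
      ((∀ b ∈ B, ¬(x ∈ b ∧ y ∈ b ∧ z ∈ b)) → g z = z) ∧
      (∀ b ∈ B, x ∈ b → y ∈ b → z ∈ b →
        ∀ w ∈ b, w ≠ x → w ≠ y → w ≠ z → g z = w))

/-- `g` is the move sequence `[a₀,…,a_k]` recorded by the list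
(elementary moves applied left to right). -/
def IsMoveSeq (B : Finset (Finset Ω)) : List Ω → Equiv.Perm Ω → Prop
  | [], _ => False
  | [_], g => g = 1
  | a :: b :: l, g => ∃ e h : Equiv.Perm Ω,
      IsElemMove B a b e ∧ IsMoveSeq B (b :: l) h ∧ g = h * e

/-- The puzzle set `𝓛_𝓓` of all move sequences. -/
def puzzleSet (B : Finset (Finset Ω)) : Set (Equiv.Perm Ω) :=
  { g | ∃ l : List Ω, IsMoveSeq B l g }

/-- The hole stabiliser `π_x(𝓓)`: all closed move sequences starting and ending at `x`. -/
def holeStab (B : Finset (Finset Ω)) (x : Ω) : Set (Equiv.Perm Ω) :=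
  { g | ∃ l : List Ω, l.head? = some x ∧ l.getLast? = some x ∧ IsMoveSeq B l g }

/-- `(Ω, B)` is a 2-(n,4,λ) design: lines have four points and every pair of distinct
points lies in exactly `lam` lines. -/
def IsTwoDesign (B : Finset (Finset Ω)) (lam : ℕ) : Prop :=
  (∀ b ∈ B, b.card = 4) ∧
  ∀ p q : Ω, p ≠ q → (B.filter fun b => p ∈ b ∧ q ∈ b).card = lam

/-- Supersimple: any two distinct lines meet in at most two points. -/
def HGSupersimple (B : Finset (Finset Ω)) : Prop :=
  ∀ b₁ ∈ B, ∀ b₂ ∈ B, b₁ ≠ b₂ → (b₁ ∩ b₂).card ≤ 2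

/-- `x ∈ overline{a,c}`: `x` is `a`, `c`, or lies on a line containing both `a` and `c`. -/
def HGLineClosure (B : Finset (Finset Ω)) (a c x : Ω) : Prop :=
  x = a ∨ x = c ∨ ∃ b ∈ B, a ∈ b ∧ c ∈ b ∧ x ∈ b

/-- A system of imprimitivity for the hole stabiliser `π_x` acting on `Ω \ {x}`,
with `ℓ` blocks each of size `k`. -/
def IsHoleBlockSystem (B : Finset (Finset Ω)) (x : Ω) (P : Finset (Finset Ω))
    (k ℓ : ℕ) : Prop :=
  P.card = ℓ ∧ 1 < k ∧ 1 < ℓ ∧ (∀ Δ ∈ P, Δ.card = k) ∧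
  (∀ a : Ω, a ≠ x → ∃! Δ : Finset Ω, Δ ∈ P ∧ a ∈ Δ) ∧
  (∀ Δ ∈ P, x ∉ Δ) ∧
  (∀ g ∈ holeStab B x, ∀ Δ ∈ P, Δ.image (⇑g) ∈ P)

/-- The graph of the elementary move `[x,y]` for `x ≠ y`. -/
def ElemMoveRel (B : Finset (Finset Ω)) (x y z w : Ω) : Prop :=
  (z = x ∧ w = y) ∨ (z = y ∧ w = x) ∨
  (z ≠ x ∧ z ≠ y ∧ w = z ∧ ∀ b ∈ B, ¬(x ∈ b ∧ y ∈ b ∧ z ∈ b)) ∨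
  (z ≠ x ∧ z ≠ y ∧ w ≠ x ∧ w ≠ y ∧ w ≠ z ∧ ∃ b ∈ B, x ∈ b ∧ y ∈ b ∧ z ∈ b ∧ w ∈ b)

lemma ElemMoveRel.symm {B : Finset (Finset Ω)} {x y z w : Ω} (h : ElemMoveRel B x y z w) :
    ElemMoveRel B x y w z := by
  unfold ElemMoveRel at *
  grind

lemma eq_of_mem_of_card_eq_four {b : Finset Ω} (hb : b.card = 4) {x y z w w' : Ω}
    (hx : x ∈ b) (hy : y ∈ b) (hz : z ∈ b) (hw : w ∈ b) (hw' : w' ∈ b)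
    (hxy : x ≠ y) (hzx : z ≠ x) (hzy : z ≠ y) (hwx : w ≠ x) (hwy : w ≠ y) (hwz : w ≠ z)
    (hwx' : w' ≠ x) (hwy' : w' ≠ y) (hwz' : w' ≠ z) : w = w' := by
  by_contra hne
  have h5 : ({x, y, z, w, w'} : Finset Ω).card = 5 := by
    rw [Finset.card_insert_of_notMem, Finset.card_insert_of_notMem,
      Finset.card_insert_of_notMem, Finset.card_pair hne] <;> grind
  have hsub : ({x, y, z, w, w'} : Finset Ω) ⊆ b := by
    intro t ht
    grind
  have := Finset.card_le_card hsub
  omega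

lemma ElemMoveRel.unique {B : Finset (Finset Ω)} (hlines : ∀ b ∈ B, b.card = 4)
    (hpl : HGPliable B) {x y z w w' : Ω} (hxy : x ≠ y)
    (h : ElemMoveRel B x y z w) (h' : ElemMoveRel B x y z w') : w = w' := by
  rcases h with h | h | h | ⟨hzx, hzy, hwx, hwy, hwz, b, hb, hx, hy, hz, hw⟩
  · unfold ElemMoveRel at h'
    grind
  · unfold ElemMoveRel at h'
    grind
  · unfold ElemMoveRel at h'
    grind
  · rcases h' with h | h | h | ⟨-, -, hwx', hwy', hwz', b', hb', hx', hy', hz', hw'⟩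
    · exact absurd h.1 hzx
    · exact absurd h.1 hzy
    · exact absurd ⟨hx, hy, hz⟩ (h.2.2.2 b hb)
    · obtain rfl := hpl b hb b' hb' x y z hxy hzx.symm hzy.symm hx hy hz hx' hy' hz'
      exact eq_of_mem_of_card_eq_four (hlines b hb) hx hy hz hw hw' hxy hzx hzy hwx hwy hwz
        hwx' hwy' hwz'

lemma exists_mem_ne_of_card_eq_four {b : Finset Ω} (hb : b.card = 4) (x y z : Ω) :
    ∃ w ∈ b, w ≠ x ∧ w ≠ y ∧ w ≠ z := by
  have h3 : ({x, y, z} : Finset Ω).card ≤ 3 := Finset.card_le_three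
  obtain ⟨w, hw, hw'⟩ := Finset.exists_mem_notMem_of_card_lt_card
    (show ({x, y, z} : Finset Ω).card < b.card by omega)
  exact ⟨w, hw, by grind⟩

lemma ElemMoveRel.exists_right {B : Finset (Finset Ω)} (hlines : ∀ b ∈ B, b.card = 4)
    (x y z : Ω) : ∃ w, ElemMoveRel B x y z w := by
  by_cases hzx : z = x
  · exact ⟨y, Or.inl ⟨hzx, rfl⟩⟩
  by_cases hzy : z = y
  · exact ⟨x, Or.inr (Or.inl ⟨hzy, rfl⟩)⟩
  by_cases hn : ∀ b ∈ B, ¬(x ∈ b ∧ y ∈ b ∧ z ∈ b)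
  · exact ⟨z, Or.inr (Or.inr (Or.inl ⟨hzx, hzy, rfl, hn⟩))⟩
  push Not at hn
  obtain ⟨b, hb, hx, hy, hz⟩ := hn
  obtain ⟨w, hw, hwx, hwy, hwz⟩ := exists_mem_ne_of_card_eq_four (hlines b hb) x y z
  exact ⟨w, Or.inr (Or.inr (Or.inr ⟨hzx, hzy, hwx, hwy, hwz, b, hb, hx, hy, hz, hw⟩))⟩

lemma IsElemMove.rel {B : Finset (Finset Ω)} (hlines : ∀ b ∈ B, b.card = 4) {x y : Ω}
    (hxy : x ≠ y) {g : Perm Ω} (h : IsElemMove B x y g) (z : Ω) :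
    ElemMoveRel B x y z (g z) := by
  obtain ⟨h, -⟩ | ⟨-, -, hgx, hgy, hg⟩ := h
  · exact absurd h hxy
  obtain ⟨w, hw⟩ := ElemMoveRel.exists_right hlines x y z
  suffices g z = w by rwa [this]
  rcases hw with ⟨rfl, rfl⟩ | ⟨rfl, rfl⟩ | ⟨hzx, hzy, rfl, hn⟩ |
    ⟨hzx, hzy, hwx, hwy, hwz, b, hb, hx, hy, hz, hw⟩
  · exact hgx
  · exact hgy
  · exact (hg _ hzx hzy).1 hn
  · exact (hg z hzx hzy).2 b hb hx hy hz w hw hwx hwy hwz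

lemma IsElemMove.unique {B : Finset (Finset Ω)} (hlines : ∀ b ∈ B, b.card = 4)
    (hpl : HGPliable B) {x y : Ω} {g h : Perm Ω} (hg : IsElemMove B x y g)
    (hh : IsElemMove B x y h) : g = h := by
  by_cases hxy : x = y
  · obtain ⟨-, rfl⟩ | ⟨hne, -⟩ := hg
    · obtain ⟨-, rfl⟩ | ⟨hne, -⟩ := hh
      · rfl
      · exact absurd hxy hne
    · exact absurd hxy hne
  · ext z
    exact (hg.rel hlines hxy z).unique hlines hpl hxy (hh.rel hlines hxy z)

lemma isElemMove_self (B : Finset (Finset Ω)) (x : Ω) : IsElemMove B x x 1 :=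
  Or.inl ⟨rfl, rfl⟩

lemma IsElemMove.symm {B : Finset (Finset Ω)} {x y : Ω} {g : Perm Ω}
    (h : IsElemMove B x y g) : IsElemMove B y x g := by
  unfold IsElemMove at *
  grind

lemma IsElemMove.mul_self {B : Finset (Finset Ω)} (hlines : ∀ b ∈ B, b.card = 4)
    (hpl : HGPliable B) {x y : Ω} {g : Perm Ω} (hg : IsElemMove B x y g) : g * g = 1 := by
  by_cases hxy : x = y
  · subst hxy
    simp [hg.unique hlines hpl (isElemMove_self B x)]
  · ext z
    exact (hg.rel hlines hxy (g z)).unique hlines hpl hxy (hg.rel hlines hxy z).symm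

lemma exists_isElemMove {B : Finset (Finset Ω)} (hlines : ∀ b ∈ B, b.card = 4)
    (hpl : HGPliable B) {x y : Ω} (hcol : HGCollinear B x y) :
    ∃ g, IsElemMove B x y g := by
  by_cases hxy : x = y
  · exact ⟨1, Or.inl ⟨hxy, rfl⟩⟩
  choose f hf using ElemMoveRel.exists_right hlines x y
  have hinv : Function.Involutive f := fun z ↦ (hf (f z)).unique hlines hpl hxy (hf z).symm
  have key : ∀ {z w}, ElemMoveRel B x y z w → f z = w :=
    fun h ↦ (hf _).unique hlines hpl hxy h
  refine ⟨hinv.toPerm, Or.inr ⟨hxy, hcol.resolve_left hxy, key (Or.inl ⟨rfl, rfl⟩),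
    key (Or.inr (Or.inl ⟨rfl, rfl⟩)), fun z hzx hzy ↦ ⟨fun hn ↦ ?_, ?_⟩⟩⟩
  · exact key (Or.inr (Or.inr (Or.inl ⟨hzx, hzy, rfl, hn⟩)))
  · intro b hb hx hy hz w hw hwx hwy hwz
    exact key (Or.inr (Or.inr (Or.inr ⟨hzx, hzy, hwx, hwy, hwz, b, hb, hx, hy, hz, hw⟩)))

lemma IsMoveSeq.append {B : Finset (Finset Ω)} {y : Ω} {l' : List Ω} {h : Perm Ω}
    (hh : IsMoveSeq B (y :: l') h) :
    ∀ {l : List Ω} {g : Perm Ω}, IsMoveSeq B (l ++ [y]) g → IsMoveSeq B (l ++ y :: l') (h * g)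
  | [], g, hg => by
    obtain rfl : g = 1 := hg
    simpa using hh
  | [a], g, hg => by
    obtain ⟨e, k, he, rfl, rfl⟩ := hg
    exact ⟨e, h, he, hh, by simp⟩
  | a :: b :: l, g, hg => by
    obtain ⟨e, k, he, hk, rfl⟩ := hg
    exact ⟨e, h * k, he, IsMoveSeq.append hh (l := b :: l) hk, (mul_assoc _ _ _).symm⟩

lemma IsMoveSeq.reverse {B : Finset (Finset Ω)} (hlines : ∀ b ∈ B, b.card = 4)
    (hpl : HGPliable B) :
    ∀ {l : List Ω} {g : Perm Ω}, IsMoveSeq B l g → IsMoveSeq B l.reverse g⁻¹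
  | [], _, hg => hg.elim
  | [a], g, hg => by
    obtain rfl : g = 1 := hg
    exact inv_one
  | a :: b :: l, g, hg => by
    obtain ⟨e, k, he, hk, rfl⟩ := hg
    have hk' := IsMoveSeq.reverse hlines hpl hk
    have he' : IsMoveSeq B [b, a] e := ⟨e, 1, he.symm, rfl, by simp⟩
    rw [List.reverse_cons] at hk'
    rw [List.reverse_cons, List.reverse_cons, List.append_assoc, mul_inv_rev,
      inv_eq_of_mul_eq_one_right (he.mul_self hlines hpl)]
    exact IsMoveSeq.append he' hk'

/-- The hole stabilizer as a subgroup. -/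
def holeStabSubgroup (B : Finset (Finset Ω)) (hlines : ∀ b ∈ B, b.card = 4)
    (hpl : HGPliable B) (x : Ω) : Subgroup (Perm Ω) where
  carrier := holeStab B x
  one_mem' := ⟨[x], rfl, rfl, rfl⟩
  mul_mem' := by
    rintro g h ⟨l, hl, hl', hg⟩ ⟨m, hm, hm', hh⟩
    obtain ⟨t, rfl⟩ := List.head?_eq_some_iff.1 hl
    obtain ⟨s, rfl⟩ := List.getLast?_eq_some_iff.1 hm'
    refine ⟨s ++ x :: t, ?_, ?_, hg.append hh⟩
    · cases s <;> simp_all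
    · simpa using hl'
  inv_mem' := by
    rintro g ⟨l, hl, hl', hg⟩
    exact ⟨l.reverse, by simpa using hl', by simpa using hl, hg.reverse hlines hpl⟩

lemma IsMoveSeq.mul_mem_closure {B : Finset (Finset Ω)} (hlines : ∀ b ∈ B, b.card = 4)
    (hpl : HGPliable B) (hcol : ∀ x y : Ω, HGCollinear B x y) {x : Ω} :
    ∀ {l : List Ω} {a : Ω} {g m : Perm Ω}, IsMoveSeq B (a :: l) g →
      (a :: l).getLast? = some x → IsElemMove B x a m →
      g * m ∈ Subgroup.closure
        { g : Perm Ω | ∃ a b : Ω, a ≠ x ∧ b ≠ x ∧ IsMoveSeq B [x, a, b, x] g }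
  | [], a, g, m, hg, hl, hm => by
    obtain rfl : g = 1 := hg
    obtain rfl : a = x := by simpa using hl
    rw [hm.unique hlines hpl (isElemMove_self B a), mul_one]
    exact one_mem _
  | b :: l, a, g, m, hg, hl, hm => by
    obtain ⟨e, h, he, hh, rfl⟩ := hg
    obtain ⟨n, hn⟩ := exists_isElemMove hlines hpl (hcol x b)
    have hl' : (b :: l).getLast? = some x := by simpa [List.getLast?_cons_cons] using hl
    have hrec := IsMoveSeq.mul_mem_closure hlines hpl hcol hh hl' hn
    have hnn := hn.mul_self hlines hpl
    have hsplit : h * e * m = h * n * (n * e * m) := by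
      rw [show h * n * (n * e * m) = h * (n * n) * e * m by group, hnn, mul_one]
    rw [hsplit]
    refine mul_mem hrec ?_
    by_cases ha : a = x
    · subst ha
      rw [hm.unique hlines hpl (isElemMove_self B a), he.unique hlines hpl hn, hnn, mul_one]
      exact one_mem _
    by_cases hb : b = x
    · subst hb
      rw [hn.unique hlines hpl (isElemMove_self B b), he.unique hlines hpl hm.symm, one_mul,
        hm.mul_self hlines hpl]
      exact one_mem _
    · exact Subgroup.subset_closure ⟨a, b, ha, hb, m, n * e, hm,
        ⟨e, n, he, ⟨n, 1, hn.symm, rfl, by simp⟩, rfl⟩, mul_assoc _ _ _⟩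

/-- (Lemma 3.1(d)) The hole stabilizer is generated by the closed
move sequences `[x,a,b,x]` with `a, b ∈ Ω \ {x}`. -/
theorem stmt2 (B : Finset (Finset Ω))
    (hlines : ∀ b ∈ B, b.card = 4) (hpl : HGPliable B)
    (hcol : ∀ x y : Ω, HGCollinear B x y) (x : Ω) :
    holeStab B x = ↑(Subgroup.closure
      { g : Equiv.Perm Ω | ∃ a b : Ω, a ≠ x ∧ b ≠ x ∧ IsMoveSeq B [x, a, b, x] g }) := by
  apply Set.Subset.antisymm
  · rintro g ⟨l, hl, hl', hg⟩
    obtain ⟨t, rfl⟩ := List.head?_eq_some_iff.1 hl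
    simpa using hg.mul_mem_closure hlines hpl hcol hl' (isElemMove_self B x)
  · change Subgroup.closure _ ≤ holeStabSubgroup B hlines hpl x
    rw [Subgroup.closure_le]
    rintro g ⟨a, b, -, -, hg⟩
    exact ⟨[x, a, b, x], rfl, rfl, hg⟩
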